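/- Any centrally symmetric convex hexagon tiles the plane by translations (hence periodically). -/

import Mathlib

open Set

/-- A convex hexagon in the Euclidean plane: six vertices listed in
counterclockwise cyclic order, with a strict left turn at every vertex. -/
structure ConvexHexagon where
  v : Fin 6 → EuclideanSpace ℝ (Fin 2)
  convex : ∀ i : Fin 6,
    0 < (v (i + 1) - v i) 0 * (v (i + 2) - v (i + 1)) 1
        - (v (i + 1) - v i) 1 * (v (i + 2) - v (i + 1)) 0

/-- The closed hexagonal region: the convex hull of the six vertices. -/
noncomputable def ConvexHexagon.region (H : ConvexHexagon) :
    Set (EuclideanSpace ℝ (Fin 2)) :=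
  convexHull ℝ (Set.range H.v)


abbrev Pl := EuclideanSpace ℝ (Fin 2)

/-- The conclusion of the theorem, for an arbitrary region. -/
def TilesByLattice (R : Set Pl) : Prop :=
    ∃ t₁ t₂ : EuclideanSpace ℝ (Fin 2),
      LinearIndependent ℝ ![t₁, t₂] ∧
      (⋃ (p : ℤ × ℤ), (fun x => x + ((p.1 : ℝ) • t₁ + (p.2 : ℝ) • t₂)) '' R)
        = Set.univ ∧
      ∀ p q : ℤ × ℤ, p ≠ q →
        Disjoint
          (interior ((fun x => x + ((p.1 : ℝ) • t₁ + (p.2 : ℝ) • t₂)) '' R))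
          (interior ((fun x => x + ((q.1 : ℝ) • t₁ + (q.2 : ℝ) • t₂)) '' R))

/-- The hull of six points symmetric about `z`. -/
def hexa (z a b c : Pl) : Set Pl :=
  convexHull ℝ {z + a, z - a, z + b, z - b, z + c, z - c}

lemma hexa_rot (z a b c : Pl) : hexa z a b c = hexa z b c a := by
  unfold hexa; congr 1; ext x; simp only [mem_insert_iff, mem_singleton_iff]; tauto

lemma hexa_neg (z a b c : Pl) : hexa z a b c = hexa z (-a) b c := by
  unfold hexa; congr 1; ext x
  simp only [mem_insert_iff, mem_singleton_iff, sub_neg_eq_add, ← sub_eq_add_neg]; tauto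

lemma interior_lt (f : Pl →ₗ[ℝ] ℝ) (u : Pl) (hu : f u ≠ 0) (S : Set Pl) (k : ℝ)
    (h : ∀ x ∈ S, f x ≤ k) (x : Pl) (hx : x ∈ interior S) : f x < k := by
  have hsurj : Function.Surjective f := fun r =>
    ⟨(r / f u) • u, by simp [div_mul_cancel₀ _ hu]⟩
  have hopen : IsOpenMap f := LinearMap.isOpenMap_of_finiteDimensional f hsurj
  have h1 : f '' interior S ⊆ interior (Iic k) := by
    apply interior_maximal _ (hopen _ isOpen_interior)
    rintro _ ⟨y, hy, rfl⟩
    exact h y (interior_subset hy)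
  rw [interior_Iic] at h1
  exact h1 ⟨x, hx, rfl⟩

lemma disj_aux (f : Pl →ₗ[ℝ] ℝ) (u : Pl) (hu : f u ≠ 0) (S : Set Pl) (z : Pl) (k : ℝ)
    (h1 : ∀ x ∈ S, f x ≤ f z + k) (h2 : ∀ x ∈ S, f z - k ≤ f x) (p q : Pl)
    (hpq : 2 * k ≤ f (q - p)) :
    Disjoint (interior ((fun x => x + p) '' S)) (interior ((fun x => x + q) '' S)) := by
  rw [Set.disjoint_left]
  intro x hx hx'
  have a1 := interior_lt f u hu _ (f z + k + f p) (by
    rintro _ ⟨y, hy, rfl⟩; have := h1 y hy; simp only [map_add]; linarith) x hx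
  have a2 := interior_lt (-f) u (by simpa using hu) _ (-(f z - k + f q)) (by
    rintro _ ⟨y, hy, rfl⟩; have := h2 y hy; simp only [map_add, LinearMap.neg_apply]; linarith) x hx'
  simp only [LinearMap.neg_apply, map_sub] at a2 hpq
  linarith

lemma tri_mem {S : Set Pl} (hS : Convex ℝ S) {z p q : Pl} (hz : z ∈ S) (hp : z + p ∈ S)
    (hq : z + q ∈ S) {u v : ℝ} (hu : 0 ≤ u) (hv : 0 ≤ v) (huv : u + v ≤ 1) :
    z + (u • p + v • q) ∈ S := by
  have := hS.sum_mem (t := Finset.univ) (w := ![1 - u - v, u, v]) (z := ![z, z + p, z + q])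
    (by intro i _; fin_cases i <;> simp <;> linarith)
    (by simp [Fin.sum_univ_three]; ring)
    (by intro i _; fin_cases i <;> simpa)
  simp only [Fin.sum_univ_three, Matrix.cons_val] at this
  convert this using 1
  module

lemma hexa_bound (f : Pl →ₗ[ℝ] ℝ) (z a b c : Pl) (k : ℝ) (ha : |f a| ≤ k) (hb : |f b| ≤ k)
    (hc : |f c| ≤ k) : (∀ x ∈ hexa z a b c, f x ≤ f z + k) ∧
      ∀ x ∈ hexa z a b c, f z - k ≤ f x := by
  rw [abs_le] at ha hb hc
  have h1 : hexa z a b c ⊆ {x | f x ≤ f z + k} := by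
    refine convexHull_min ?_ (convex_halfSpace_le f.isLinear _)
    intro x hx
    simp only [mem_insert_iff, mem_singleton_iff] at hx
    rcases hx with rfl | rfl | rfl | rfl | rfl | rfl <;>
      simp only [mem_ofPred_eq, map_add, map_sub] <;> linarith
  have h2 : hexa z a b c ⊆ {x | f z - k ≤ f x} := by
    refine convexHull_min ?_ (convex_halfSpace_ge f.isLinear _)
    intro x hx
    simp only [mem_insert_iff, mem_singleton_iff] at hx
    rcases hx with rfl | rfl | rfl | rfl | rfl | rfl <;>
      simp only [mem_ofPred_eq, map_add, map_sub] <;> linarith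
  exact ⟨fun x hx => h1 hx, fun x hx => h2 hx⟩

lemma hexa_mem (z a b : Pl) (α β : ℝ) (hα : 0 < α) (hβ : 0 < β) (x y : ℝ)
    (h1 : |β * x + (1 - α) * y| ≤ β) (h2 : |(1 - β) * x + α * y| ≤ α) (h3 : |y - x| ≤ 1) :
    z + (x • a + y • b) ∈ hexa z a b (α • a + β • b) := by
  set w := α • a + β • b with hw
  have hS : Convex ℝ (hexa z a b w) := convex_convexHull _ _
  have hsub : ∀ p ∈ ({z + a, z - a, z + b, z - b, z + w, z - w} : Set Pl), p ∈ hexa z a b w :=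
    fun p hp => subset_convexHull ℝ _ hp
  have pa : z + a ∈ hexa z a b w := hsub _ (by simp)
  have na : z + -a ∈ hexa z a b w := hsub _ (by simp [sub_eq_add_neg])
  have pb : z + b ∈ hexa z a b w := hsub _ (by simp)
  have nb : z + -b ∈ hexa z a b w := hsub _ (by simp [sub_eq_add_neg])
  have pw : z + w ∈ hexa z a b w := hsub _ (by simp)
  have nw : z + -w ∈ hexa z a b w := hsub _ (by simp only [sub_eq_add_neg]; simp)
  have hz : z ∈ hexa z a b w := by
    have := hS pa na (by norm_num : (0:ℝ) ≤ 1/2) (by norm_num : (0:ℝ) ≤ 1/2) (by norm_num)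
    convert this using 1
    module
  rw [abs_le] at h1 h2 h3
  -- sector lemmas
  have key1 : ∀ x y : ℝ, 0 ≤ y → α * y ≤ β * x → β * x + (1 - α) * y ≤ β →
      0 ≤ x - α * y / β ∧ 0 ≤ y / β ∧ (x - α * y / β) + y / β ≤ 1 := by
    intro x y hy hxy h
    refine ⟨?_, by positivity, ?_⟩
    · rw [sub_nonneg, div_le_iff₀ hβ]; linarith
    · have : x - α * y / β + y / β = (β * x + (1 - α) * y) / β := by field_simp; ring
      rw [this, div_le_one hβ]; exact h
  have key2 : ∀ x y : ℝ, 0 ≤ x → β * x ≤ α * y → (1 - β) * x + α * y ≤ α →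
      0 ≤ y - β * x / α ∧ 0 ≤ x / α ∧ (y - β * x / α) + x / α ≤ 1 := by
    intro x y hy hxy h
    refine ⟨?_, by positivity, ?_⟩
    · rw [sub_nonneg, div_le_iff₀ hα]; linarith
    · have : y - β * x / α + x / α = ((1 - β) * x + α * y) / α := by field_simp; ring
      rw [this, div_le_one hα]; exact h
  have e1 : x • a + y • b = (x - α * y / β) • a + (y / β) • w := by
    rw [hw]; match_scalars <;> field_simp <;> ring
  have e2 : x • a + y • b = (y - β * x / α) • b + (x / α) • w := by
    rw [hw]; match_scalars <;> field_simp <;> ring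
  rcases le_total 0 x with hx | hx <;> rcases le_total 0 y with hy | hy
  · rcases le_total (α * y) (β * x) with h | h
    · obtain ⟨q1, q2, q3⟩ := key1 x y hy h (by linarith)
      rw [e1]; exact tri_mem hS hz pa pw q1 q2 q3
    · obtain ⟨q1, q2, q3⟩ := key2 x y hx h (by linarith)
      rw [e2]; exact tri_mem hS hz pb pw q1 q2 q3
  · have := tri_mem hS hz pa nb hx (by linarith : 0 ≤ -y) (by linarith)
    simpa using this
  · have := tri_mem hS hz na pb (by linarith : 0 ≤ -x) hy (by linarith)
    simpa using this
  · rcases le_total (α * y) (β * x) with h | h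
    · obtain ⟨q1, q2, q3⟩ := key2 (-x) (-y) (by linarith) (by linarith) (by linarith)
      rw [e2]
      have := tri_mem hS hz nb nw q1 q2 q3
      convert this using 2
      module
    · obtain ⟨q1, q2, q3⟩ := key1 (-x) (-y) (by linarith) (by linarith) (by linarith)
      rw [e1]
      have := tri_mem hS hz na nw q1 q2 q3
      convert this using 2
      module

/-- Points of the hexagon, in lattice coordinates. -/
def InHex (α β s r : ℝ) : Prop :=
  |2 * β * s + (1 + β - α) * r| ≤ β ∧ |(1 + α - β) * s + 2 * α * r| ≤ α ∧
    |(1 + β - α) * r - (1 + α - β) * s| ≤ 1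

lemma InHex.neg {α β s r : ℝ} (h : InHex α β s r) : InHex α β (-s) (-r) := by
  obtain ⟨h1, h2, h3⟩ := h
  refine ⟨?_, ?_, ?_⟩
  · rw [← abs_neg]; convert h1 using 2; ring
  · rw [← abs_neg]; convert h2 using 2; ring
  · rw [← abs_neg]; convert h3 using 2; ring

lemma InHex.swap {α β s r : ℝ} (h : InHex α β s r) : InHex β α r s := by
  obtain ⟨h1, h2, h3⟩ := h
  refine ⟨?_, ?_, ?_⟩
  · convert h2 using 2; ring
  · convert h1 using 2; ring
  · rw [← abs_neg]; convert h3 using 2; ring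

lemma inHex_zero (α β s r : ℝ) (hα : 0 < α) (hβ : 0 < β) (hα1 : α ≤ 1) (hβ1 : β ≤ 1)
    (hs : 0 ≤ s) (hr : 0 ≤ r)
    (h1 : 2 * β * s + (1 + β - α) * r ≤ β) (h2 : (1 + α - β) * s + 2 * α * r ≤ α) :
    InHex α β s r := by
  have p1 : 0 ≤ (1 + β - α) * r := mul_nonneg (by linarith) hr
  have p2 : 0 ≤ (1 + α - β) * s := mul_nonneg (by linarith) hs
  have p3 : 0 ≤ β * s := by positivity
  have p4 : 0 ≤ α * r := by positivity
  have s2 : s ≤ 1/2 := by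
    by_contra h; push Not at h; nlinarith
  have r2 : r ≤ 1/2 := by
    by_contra h; push Not at h; nlinarith
  have b1 : (1 + β - α) * r ≤ 1 := by nlinarith
  have b2 : (1 + α - β) * s ≤ 1 := by nlinarith
  refine ⟨?_, ?_, ?_⟩ <;> rw [abs_le] <;> constructor <;> linarith

lemma inHex_one (α β s r : ℝ) (hα : 0 < α) (hβ : 0 < β) (hα1 : α ≤ 1) (hβ1 : β ≤ 1)
    (hab : 1 ≤ α + β)
    (hs : 0 ≤ s) (hr : 0 ≤ r) (hsr : s + r ≤ 1)
    (h1 : β ≤ 2 * β * s + (1 + β - α) * r)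
    (h3 : (1 + β - α) * r - (1 + α - β) * s ≤ β - α) :
    InHex α β (s - 1) r := by
  obtain ⟨p, rfl⟩ : ∃ p, s = 1 - r - p := ⟨1 - r - s, by ring⟩
  have hp : 0 ≤ p := by linarith
  have g1 : 0 ≤ (1 + α - β) * p := mul_nonneg (by linarith) hp
  have g2 : 0 ≤ (α + β - 1) * r := mul_nonneg (by linarith) hr
  have g3 : 0 ≤ β * p := by positivity
  have p2 : p ≤ 1/2 := by
    by_contra h; push Not at h; nlinarith
  have r2 : r ≤ 1/2 := by nlinarith
  have g4 : (1 + α - β) * p ≤ α := by nlinarith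
  have g5 : (α + β - 1) * r ≤ α := by nlinarith
  refine ⟨?_, ?_, ?_⟩ <;> rw [abs_le] <;> constructor <;> nlinarith

lemma excl (α β x y : ℝ) (hα : 0 < α) (hβ : 0 < β) (hα1 : α ≤ 1) (hβ1 : β ≤ 1)
    (hab : 1 ≤ α + β) (h1 : β * x + (1 - α) * y ≤ 0) (h2 : 0 < (1 - β) * x + α * y)
    (h3 : y - x < 0) : False := by
  have hx : 0 < x := by
    by_contra h; push Not at h; nlinarith
  have e : (1 - α) * ((1 - β) * x + α * y) - α * (β * x + (1 - α) * y) = (1 - α - β) * x := by ring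
  have e1 : (1 - α - β) * x ≤ 0 := mul_nonpos_of_nonpos_of_nonneg (by linarith) hx.le
  rcases eq_or_lt_of_le hα1 with h | h
  · subst h; nlinarith
  · have := mul_pos (sub_pos.2 h) h2
    nlinarith

lemma inHex_tri (α β s r : ℝ) (hα : 0 < α) (hβ : 0 < β) (hα1 : α ≤ 1) (hβ1 : β ≤ 1)
    (hab : 1 ≤ α + β) (hs : 0 ≤ s) (hr : 0 ≤ r) (hsr : s + r ≤ 1) :
    InHex α β s r ∨ InHex α β (s - 1) r ∨ InHex α β s (r - 1) := by
  -- coordinates of the point minus `w`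
  set x := (1 + α) * s + α * r - α with hx
  set y := β * s + (1 + β) * r - β with hy
  by_cases c1 : 2 * β * s + (1 + β - α) * r ≤ β
  · by_cases c2 : (1 + α - β) * s + 2 * α * r ≤ α
    · exact Or.inl (inHex_zero α β s r hα hβ hα1 hβ1 hs hr c1 c2)
    · push Not at c2
      by_cases c3 : (1 + β - α) * r - (1 + α - β) * s < β - α
      · exact (excl α β x y hα hβ hα1 hβ1 hab (by rw [hx, hy]; linarith)
          (by rw [hx, hy]; linarith) (by rw [hx, hy]; linarith)).elim
      · push Not at c3
        right; right
        exact (inHex_one β α r s hβ hα hβ1 hα1 (by linarith) hr hs (by linarith)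
          (by linarith) (by linarith)).swap
  · push Not at c1
    by_cases c3 : (1 + β - α) * r - (1 + α - β) * s ≤ β - α
    · right; left
      exact inHex_one α β s r hα hβ hα1 hβ1 hab hs hr hsr c1.le c3
    · push Not at c3
      by_cases c2 : (1 + α - β) * s + 2 * α * r ≤ α
      · exact (excl β α y x hβ hα hβ1 hα1 (by linarith) (by rw [hx, hy]; linarith)
          (by rw [hx, hy]; linarith) (by rw [hx, hy]; linarith)).elim
      · push Not at c2
        right; right
        exact (inHex_one β α r s hβ hα hβ1 hα1 (by linarith) hr hs (by linarith)
          (by linarith) (by linarith)).swap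

lemma inHex_cover (α β s r : ℝ) (hα : 0 < α) (hβ : 0 < β) (hα1 : α ≤ 1) (hβ1 : β ≤ 1)
    (hab : 1 ≤ α + β) : ∃ m n : ℤ, InHex α β (s - m) (r - n) := by
  have s0 := Int.fract_nonneg s
  have s1 := (Int.fract_lt_one s).le
  have r0 := Int.fract_nonneg r
  have r1 := (Int.fract_lt_one r).le
  have es : s = ⌊s⌋ + Int.fract s := (Int.floor_add_fract s).symm
  have er : r = ⌊r⌋ + Int.fract r := (Int.floor_add_fract r).symm
  set S := Int.fract s
  set T := Int.fract r
  suffices h : ∃ m n : ℤ, InHex α β (S - m) (T - n) by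
    obtain ⟨m, n, h⟩ := h
    refine ⟨⌊s⌋ + m, ⌊r⌋ + n, ?_⟩
    convert h using 1 <;> push_cast <;> linarith
  rcases le_total (S + T) 1 with h | h
  · rcases inHex_tri α β S T hα hβ hα1 hβ1 hab s0 r0 h with h | h | h
    · exact ⟨0, 0, by simpa using h⟩
    · exact ⟨1, 0, by simpa using h⟩
    · exact ⟨0, 1, by simpa using h⟩
  · rcases inHex_tri α β (1 - S) (1 - T) hα hβ hα1 hβ1 hab (by linarith) (by linarith)
      (by linarith) with h | h | h
    · exact ⟨1, 1, by simpa using h.neg⟩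
    · exact ⟨0, 1, by simpa using h.neg⟩
    · exact ⟨1, 0, by simpa using h.neg⟩

lemma core (z a b : Pl) (φ ψ : Pl →ₗ[ℝ] ℝ) (hrep : ∀ x, x = φ x • a + ψ x • b)
    (ha : φ a = 1) (hb : φ b = 0) (ha' : ψ a = 0) (hb' : ψ b = 1)
    (α β : ℝ) (hα : 0 < α) (hβ : 0 < β) (hα1 : α ≤ 1) (hβ1 : β ≤ 1)
    (hab : 1 ≤ α + β) : TilesByLattice (hexa z a b (α • a + β • b)) := by
  set w := α • a + β • b with hw
  have hwφ : φ w = α := by simp [hw, ha, hb]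
  have hwψ : ψ w = β := by simp [hw, ha', hb']
  refine ⟨a + w, w + b, ?_, ?_, ?_⟩
  · rw [LinearIndependent.pair_iff]
    intro s t h
    have h1 := congrArg φ h
    have h2 := congrArg ψ h
    simp only [map_add, map_smul, ha, hb, ha', hb', hwφ, hwψ, smul_eq_mul, map_zero] at h1 h2
    have hD : (1 + α + β) ≠ 0 := by positivity
    constructor
    · apply (mul_eq_zero.1 (_ : (1 + α + β) * s = 0)).resolve_left hD
      linear_combination (1 + β) * h1 - α * h2
    · apply (mul_eq_zero.1 (_ : (1 + α + β) * t = 0)).resolve_left hD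
      linear_combination (1 + α) * h2 - β * h1
  · rw [eq_univ_iff_forall]
    intro x
    have hD : (1 + α + β) ≠ 0 := by positivity
    set X := φ (x - z) with hX
    set Y := ψ (x - z) with hY
    set s := ((1 + β) * X - α * Y) / (1 + α + β) with hs
    set r := ((1 + α) * Y - β * X) / (1 + α + β) with hr
    have hXs : X = (1 + α) * s + α * r := by rw [hs, hr]; field_simp; ring
    have hYs : Y = β * s + (1 + β) * r := by rw [hs, hr]; field_simp; ring
    obtain ⟨m, n, h1, h2, h3⟩ := inHex_cover α β s r hα hβ hα1 hβ1 hab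
    rw [mem_iUnion]
    refine ⟨(m, n), z + (((1 + α) * (s - m) + α * (r - n)) • a +
      (β * (s - m) + (1 + β) * (r - n)) • b), ?_, ?_⟩
    · apply hexa_mem z a b α β hα hβ
      · convert h1 using 2; ring
      · convert h2 using 2; ring
      · convert h3 using 2; ring
    · have hx : x = z + (X • a + Y • b) := by
        rw [← hrep (x - z)]; abel
      rw [hx, hXs, hYs, hw]
      simp only
      module
  · -- disjointness
    let f1 : Pl →ₗ[ℝ] ℝ := β • φ + (1 - α) • ψ
    let f2 : Pl →ₗ[ℝ] ℝ := (1 - β) • φ + α • ψ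
    let f3 : Pl →ₗ[ℝ] ℝ := ψ - φ
    have E1 : ∀ x, f1 x = β * φ x + (1 - α) * ψ x := fun x => rfl
    have E2 : ∀ x, f2 x = (1 - β) * φ x + α * ψ x := fun x => rfl
    have E3 : ∀ x, f3 x = ψ x - φ x := fun x => rfl
    obtain ⟨B1, B1'⟩ := hexa_bound f1 z a b w β
      (by rw [E1, ha, ha', abs_le]; constructor <;> linarith)
      (by rw [E1, hb, hb', abs_le]; constructor <;> linarith)
      (by rw [E1, hwφ, hwψ, abs_le]; constructor <;> linarith)
    obtain ⟨B2, B2'⟩ := hexa_bound f2 z a b w α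
      (by rw [E2, ha, ha', abs_le]; constructor <;> linarith)
      (by rw [E2, hb, hb', abs_le]; constructor <;> linarith)
      (by rw [E2, hwφ, hwψ, abs_le]; constructor <;> linarith)
    obtain ⟨B3, B3'⟩ := hexa_bound f3 z a b w 1
      (by rw [E3, ha, ha', abs_le]; constructor <;> linarith)
      (by rw [E3, hb, hb', abs_le]; constructor <;> linarith)
      (by rw [E3, hwφ, hwψ, abs_le]; constructor <;> linarith)
    have N1 : f1 a ≠ 0 := by rw [E1, ha, ha']; simp; positivity
    have N2 : f2 b ≠ 0 := by rw [E2, hb, hb']; simp; positivity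
    have N3 : f3 b ≠ 0 := by rw [E3, hb, hb']; simp
    -- main: one half-plane of directions
    have main : ∀ p q : ℤ × ℤ,
        ((1 ≤ q.1 - p.1 ∧ 0 ≤ q.2 - p.2) ∨ (0 ≤ q.1 - p.1 ∧ 1 ≤ q.2 - p.2) ∨
          (q.1 - p.1 ≤ -1 ∧ 1 ≤ q.2 - p.2)) →
        Disjoint
          (interior ((fun x => x + ((p.1 : ℝ) • (a + w) + (p.2 : ℝ) • (w + b))) '' hexa z a b w))
          (interior ((fun x => x + ((q.1 : ℝ) • (a + w) + (q.2 : ℝ) • (w + b))) ''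
            hexa z a b w)) := by
      intro p q h
      have d1 : 0 ≤ 1 + β - α := by linarith
      have d2 : 0 ≤ 1 + α - β := by linarith
      rcases h with ⟨h, h'⟩ | ⟨h, h'⟩ | ⟨h, h'⟩
      · have h : (1:ℝ) ≤ q.1 - p.1 := by exact_mod_cast h
        have h' : (0:ℝ) ≤ q.2 - p.2 := by exact_mod_cast h'
        apply disj_aux f1 a N1 _ z β B1 B1'
        rw [E1]
        simp only [map_sub, map_add, map_smul, ha, hb, ha', hb', hwφ, hwψ, smul_eq_mul]
        have := mul_nonneg d1 h'
        have := mul_nonneg hβ.le (sub_nonneg.2 h)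
        linarith
      · have h : (0:ℝ) ≤ q.1 - p.1 := by exact_mod_cast h
        have h' : (1:ℝ) ≤ q.2 - p.2 := by exact_mod_cast h'
        apply disj_aux f2 b N2 _ z α B2 B2'
        rw [E2]
        simp only [map_sub, map_add, map_smul, ha, hb, ha', hb', hwφ, hwψ, smul_eq_mul]
        have := mul_nonneg d2 h
        have := mul_nonneg hα.le (sub_nonneg.2 h')
        linarith
      · have h : (q.1 - p.1 : ℝ) ≤ -1 := by exact_mod_cast h
        have h' : (1:ℝ) ≤ q.2 - p.2 := by exact_mod_cast h'
        apply disj_aux f3 b N3 _ z 1 B3 B3'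
        rw [E3]
        simp only [map_sub, map_add, map_smul, ha, hb, ha', hb', hwφ, hwψ, smul_eq_mul]
        have := mul_nonneg d1 (sub_nonneg.2 h')
        have := mul_nonneg d2 (sub_nonneg.2 h)
        linarith
    intro p q hpq
    have hne : q.1 - p.1 ≠ 0 ∨ q.2 - p.2 ≠ 0 := by
      by_contra h
      push Not at h
      exact hpq (Prod.ext (by linarith [h.1]) (by linarith [h.2]))
    by_cases hc : ((1 ≤ q.1 - p.1 ∧ 0 ≤ q.2 - p.2) ∨ (0 ≤ q.1 - p.1 ∧ 1 ≤ q.2 - p.2) ∨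
          (q.1 - p.1 ≤ -1 ∧ 1 ≤ q.2 - p.2))
    · exact main p q hc
    · exact (main q p (by omega)).symm

/-- The planar cross product. -/
def cr (x y : Pl) : ℝ := x 0 * y 1 - x 1 * y 0

lemma pl_ext {x y : Pl} (h0 : x 0 = y 0) (h1 : x 1 = y 1) : x = y := by
  ext i; fin_cases i <;> assumption

lemma mid_pos (z a b : Pl) (h : cr a b ≠ 0) (α β : ℝ) (hα : 0 ≤ α) (hβ : 0 ≤ β)
    (hα1 : α ≤ 1) (hβ1 : β ≤ 1) : TilesByLattice (hexa z a b (α • a + β • b)) := by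
  let φ : Pl →ₗ[ℝ] ℝ :=
    { toFun := fun x => cr x b / cr a b
      map_add' := by intro x y; simp [cr]; ring
      map_smul' := by intro m x; simp [cr]; ring }
  let ψ : Pl →ₗ[ℝ] ℝ :=
    { toFun := fun x => cr a x / cr a b
      map_add' := by intro x y; simp [cr]; ring
      map_smul' := by intro m x; simp [cr]; ring }
  have e1 : ∀ x, φ x = cr x b / cr a b := fun x => rfl
  have e2 : ∀ x, ψ x = cr a x / cr a b := fun x => rfl
  have hrep : ∀ x, x = φ x • a + ψ x • b := by
    intro x
    rw [e1, e2]
    apply pl_ext <;> simp only [PiLp.add_apply, PiLp.smul_apply, smul_eq_mul] <;>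
      rw [div_mul_eq_mul_div, div_mul_eq_mul_div, ← add_div, eq_div_iff h] <;> simp only [cr] <;> ring
  have ha : φ a = 1 := by rw [e1, div_self h]
  have hb : φ b = 0 := by rw [e1]; simp [cr, mul_comm]
  have ha' : ψ a = 0 := by rw [e2]; simp [cr, mul_comm]
  have hb' : ψ b = 1 := by rw [e2, div_self h]
  rcases le_or_gt (α + β) 1 with hle | hgt
  · have key : ∀ α β : ℝ, 0 ≤ α → 0 ≤ β → α + β ≤ 1 →
        hexa z a b (α • a + β • b) = convexHull ℝ {z + a, z - a, z + b, z - b} := by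
      intro α β hα hβ hle
      set T := convexHull ℝ ({z + a, z - a, z + b, z - b} : Set Pl) with hT
      have hTc : Convex ℝ T := convex_convexHull _ _
      have hsub : ∀ p ∈ ({z + a, z - a, z + b, z - b} : Set Pl), p ∈ T :=
        fun p hp => subset_convexHull ℝ _ hp
      have pa : z + a ∈ T := hsub _ (by simp)
      have na : z + -a ∈ T := hsub _ (by simp [sub_eq_add_neg])
      have pb : z + b ∈ T := hsub _ (by simp)
      have nb : z + -b ∈ T := hsub _ (by simp [sub_eq_add_neg])
      have hz : z ∈ T := by
        have := hTc pa na (by norm_num : (0:ℝ) ≤ 1/2) (by norm_num : (0:ℝ) ≤ 1/2) (by norm_num)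
        convert this using 1
        module
      apply Set.Subset.antisymm
      · refine convexHull_min ?_ hTc
        intro x hx
        simp only [mem_insert_iff, mem_singleton_iff] at hx
        rcases hx with rfl | rfl | rfl | rfl | rfl | rfl
        · exact pa
        · simpa [sub_eq_add_neg] using na
        · exact pb
        · simpa [sub_eq_add_neg] using nb
        · exact tri_mem hTc hz pa pb hα hβ hle
        · have := tri_mem hTc hz na nb hα hβ hle
          convert this using 1
          module
      · apply convexHull_mono
        intro x hx
        simp only [mem_insert_iff, mem_singleton_iff] at hx ⊢
        tauto
    rw [key α β hα hβ hle, ← key (1/2) (1/2) (by norm_num) (by norm_num) (by norm_num)]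
    exact core z a b φ ψ hrep ha hb ha' hb' (1/2) (1/2) (by norm_num) (by norm_num)
      (by norm_num) (by norm_num) (by norm_num)
  · exact core z a b φ ψ hrep ha hb ha' hb' α β (by linarith) (by linarith) hα1 hβ1 hgt.le

lemma mid_abs (z a b : Pl) (h : cr a b ≠ 0) (α β : ℝ)
    (hα1 : |α| ≤ 1) (hβ1 : |β| ≤ 1) : TilesByLattice (hexa z a b (α • a + β • b)) := by
  have cneg1 : cr (-a) b ≠ 0 := by
    intro h'; apply h; simp [cr] at h' ⊢; linarith
  have cneg2 : cr a (-b) ≠ 0 := by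
    intro h'; apply h; simp [cr] at h' ⊢; linarith
  have cneg3 : cr (-a) (-b) ≠ 0 := by
    intro h'; apply h; simp [cr] at h' ⊢; linarith
  have hneg2 : ∀ a b c : Pl, hexa z a b c = hexa z a (-b) c := by
    intro a b c
    rw [hexa_rot, hexa_neg, hexa_rot, hexa_rot]
  rw [abs_le] at hα1 hβ1
  rcases le_total 0 α with h1 | h1 <;> rcases le_total 0 β with h2 | h2
  · exact mid_pos z a b h α β h1 h2 hα1.2 hβ1.2
  · have := mid_pos z a (-b) cneg2 α (-β) h1 (by linarith) hα1.2 (by linarith)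
    rw [← hneg2] at this
    simpa using this
  · have := mid_pos z (-a) b cneg1 (-α) β (by linarith) h2 (by linarith) hβ1.2
    rw [← hexa_neg] at this
    simpa using this
  · have := mid_pos z (-a) (-b) cneg3 (-α) (-β) (by linarith) (by linarith) (by linarith)
      (by linarith)
    rw [← hneg2, ← hexa_neg] at this
    simpa using this

lemma mid_max (z a b c : Pl) (h : cr a b ≠ 0) (h1 : |cr b c| ≤ |cr a b|)
    (h2 : |cr c a| ≤ |cr a b|) : TilesByLattice (hexa z a b c) := by
  have hc : c = (-(cr b c / cr a b)) • a + (-(cr c a / cr a b)) • b := by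
    apply pl_ext <;> simp only [PiLp.add_apply, PiLp.smul_apply, smul_eq_mul] <;>
      rw [← neg_div, ← neg_div, div_mul_eq_mul_div, div_mul_eq_mul_div, ← add_div,
        eq_div_iff h] <;> simp only [cr] <;> ring
  rw [hc]
  apply mid_abs z a b h
  · rw [abs_neg, abs_div]; exact div_le_one_of_le₀ h1 (abs_nonneg _)
  · rw [abs_neg, abs_div]; exact div_le_one_of_le₀ h2 (abs_nonneg _)

lemma mid_all (z a b c : Pl) (h : ¬ (cr a b = 0 ∧ cr b c = 0 ∧ cr c a = 0)) :
    TilesByLattice (hexa z a b c) := by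
  by_cases m1 : |cr b c| ≤ |cr a b| ∧ |cr c a| ≤ |cr a b|
  · apply mid_max z a b c _ m1.1 m1.2
    intro h0
    rw [h0, abs_zero] at m1
    exact h ⟨h0, abs_nonpos_iff.1 m1.1, abs_nonpos_iff.1 m1.2⟩
  · by_cases m2 : |cr c a| ≤ |cr b c| ∧ |cr a b| ≤ |cr b c|
    · rw [hexa_rot]
      apply mid_max z b c a _ m2.1 m2.2
      intro h0
      rw [h0, abs_zero] at m2
      exact h ⟨abs_nonpos_iff.1 m2.2, h0, abs_nonpos_iff.1 m2.1⟩
    · have m3 : |cr a b| ≤ |cr c a| ∧ |cr b c| ≤ |cr c a| := by grind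
      rw [hexa_rot, hexa_rot]
      apply mid_max z c a b _ m3.1 m3.2
      intro h0
      rw [h0, abs_zero] at m3
      exact h ⟨abs_nonpos_iff.1 m3.1, abs_nonpos_iff.1 m3.2, h0⟩

/-- A set of at most six points with a fixed-point-free involution consists of three pairs. -/
lemma three_pairs (E : Set Pl) (hfin : E.Finite) (hcard : E.ncard ≤ 6) (hne : E.Nonempty)
    (c : Pl) (hs : ∀ x ∈ E, c - x ∈ E) (hf : ∀ x ∈ E, c - x ≠ x) :
    ∃ p ∈ E, ∃ q ∈ E, ∃ r ∈ E, E ⊆ {p, c - p, q, c - q, r, c - r} := by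
  by_contra hcon
  push Not at hcon
  obtain ⟨p, hp⟩ := hne
  obtain ⟨q, hq, hq'⟩ := not_subset.1 (hcon p hp p hp p hp)
  obtain ⟨r, hr, hr'⟩ := not_subset.1 (hcon p hp q hq q hq)
  obtain ⟨s, hs1, hs'⟩ := not_subset.1 (hcon p hp q hq r hr)
  simp only [mem_insert_iff, mem_singleton_iff, not_or] at hq' hr' hs'
  have sw : ∀ x y : Pl, x ≠ c - y → c - x ≠ y := fun x y h h' => h (by rw [← h']; abel)
  have inj : ∀ x y : Pl, x ≠ y → c - x ≠ c - y := fun x y h h' => h (by simpa using h')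
  classical
  have hsub : ((({p, c - p, q, c - q, r, c - r, s} : Finset Pl)) : Set Pl) ⊆ E := by
    intro x hx
    simp only [Finset.coe_insert, Finset.coe_singleton, mem_insert_iff, mem_singleton_iff] at hx
    rcases hx with rfl | rfl | rfl | rfl | rfl | rfl | rfl
    · exact hp
    · exact hs _ hp
    · exact hq
    · exact hs _ hq
    · exact hr
    · exact hs _ hr
    · exact hs1
  have hc7 : ({p, c - p, q, c - q, r, c - r, s} : Finset Pl).card = 7 := by
    have fp := hf p hp
    have fq := hf q hq
    have fr := hf r hr
    obtain ⟨q1, q2, -⟩ := hq'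
    obtain ⟨r1, r2, r3, r4, -⟩ := hr'
    obtain ⟨s1, s2, s3, s4, s5, s6⟩ := hs'
    have := sw _ _ q2
    have := sw _ _ r2
    have := sw _ _ r4
    have := inj _ _ q1
    have := inj _ _ r1
    have := inj _ _ r3
    rw [Finset.card_insert_of_notMem, Finset.card_insert_of_notMem, Finset.card_insert_of_notMem,
      Finset.card_insert_of_notMem, Finset.card_insert_of_notMem, Finset.card_insert_of_notMem,
      Finset.card_singleton] <;>
    simp only [Finset.mem_insert, Finset.mem_singleton, not_or] <;> and_intros <;>
    first | assumption | exact Ne.symm (by assumption)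
  have := Set.ncard_le_ncard hsub hfin
  rw [Set.ncard_coe_finset, hc7] at this
  omega

lemma hexa_coords (z a b c x : Pl) (hx : x ∈ hexa z a b c) :
    ∃ i j k : ℝ, x = z + (i • a + j • b + k • c) := by
  have hconv : Convex ℝ {x : Pl | ∃ i j k : ℝ, x = z + (i • a + j • b + k • c)} := by
    rintro _ ⟨i, j, k, rfl⟩ _ ⟨i', j', k', rfl⟩ u v hu hv huv
    refine ⟨u * i + v * i', u * j + v * j', u * k + v * k', ?_⟩
    obtain rfl : v = 1 - u := by linarith
    module
  refine convexHull_min ?_ hconv hx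
  intro y hy
  simp only [mem_insert_iff, mem_singleton_iff] at hy
  rcases hy with rfl | rfl | rfl | rfl | rfl | rfl
  · exact ⟨1, 0, 0, by module⟩
  · exact ⟨-1, 0, 0, by module⟩
  · exact ⟨0, 1, 0, by module⟩
  · exact ⟨0, -1, 0, by module⟩
  · exact ⟨0, 0, 1, by module⟩
  · exact ⟨0, 0, -1, by module⟩

lemma region_hexa (H : ConvexHexagon) (c : Pl)
    (hc : (fun x => c - x) '' H.region = H.region) :
    ∃ z a b d : Pl, H.region = hexa z a b d := by
  have hconv : Convex ℝ H.region := convex_convexHull _ _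
  have hcomp : IsCompact H.region := (finite_range H.v).isCompact_convexHull ℝ
  have hvm : ∀ i, H.v i ∈ H.region := fun i => subset_convexHull ℝ _ (mem_range_self i)
  have hsym : ∀ x ∈ H.region, c - x ∈ H.region := fun x hx => by
    rw [← hc]; exact ⟨x, hx, rfl⟩
  set E := extremePoints ℝ H.region with hE
  have hEsub : E ⊆ range H.v := extremePoints_convexHull_subset
  have hfin : E.Finite := (finite_range H.v).subset hEsub
  have hcard : E.ncard ≤ 6 := by
    refine (Set.ncard_le_ncard hEsub (finite_range _)).trans ?_
    rw [← image_univ]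
    refine (Set.ncard_image_le finite_univ).trans ?_
    simp [Set.ncard_univ]
  have hKM : convexHull ℝ E = H.region := by
    have h := closure_convexHull_extremePoints hcomp hconv
    rwa [(hfin.isClosed_convexHull ℝ).closure_eq] at h
  have hne : E.Nonempty := hcomp.extremePoints_nonempty ⟨_, hvm 0⟩
  have hEs : ∀ x ∈ E, c - x ∈ E := by
    intro x hx
    rw [hE, mem_extremePoints] at hx ⊢
    refine ⟨hsym _ hx.1, ?_⟩
    intro y hy y' hy' ho
    obtain ⟨u, v, hu, hv, huv, he⟩ := ho
    have := hx.2 (c - y) (hsym y hy) (c - y') (hsym y' hy') ⟨u, v, hu, hv, huv, by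
      have : x = c - (u • y + v • y') := by rw [he]; abel
      rw [this]
      obtain rfl : v = 1 - u := by linarith
      module⟩
    constructor
    · rw [← this.1]; abel
    · rw [← this.2]; abel
  have hEf : ∀ x ∈ E, c - x ≠ x := by
    intro x hx hfix
    rw [hE, mem_extremePoints] at hx
    have hall : ∀ y ∈ H.region, y = x := by
      intro y hy
      refine (hx.2 y hy (c - y) (hsym y hy) ⟨1/2, 1/2, by norm_num, by norm_num, by norm_num, ?_⟩).1
      have : c = x + x := by rw [← sub_eq_iff_eq_add]; exact hfix
      rw [this]; module
    have h0 := H.convex 0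
    rw [hall _ (hvm (0 + 1)), hall _ (hvm 0)] at h0
    simp at h0
  obtain ⟨p, hp, q, hq, r, hr, hsub⟩ := three_pairs E hfin hcard hne c hEs hEf
  have hEq : E = {p, c - p, q, c - q, r, c - r} := by
    apply Set.Subset.antisymm hsub
    intro x hx
    simp only [mem_insert_iff, mem_singleton_iff] at hx
    rcases hx with rfl | rfl | rfl | rfl | rfl | rfl
    · exact hp
    · exact hEs _ hp
    · exact hq
    · exact hEs _ hq
    · exact hr
    · exact hEs _ hr
  refine ⟨(1/2 : ℝ) • c, p - (1/2 : ℝ) • c, q - (1/2 : ℝ) • c, r - (1/2 : ℝ) • c, ?_⟩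
  rw [← hKM, hEq, hexa]
  have e1 : ∀ p : Pl, (1/2 : ℝ) • c + (p - (1/2 : ℝ) • c) = p := fun p => by abel
  have e2 : ∀ p : Pl, (1/2 : ℝ) • c - (p - (1/2 : ℝ) • c) = c - p := fun p => by module
  simp only [e1, e2]

/-- Any centrally symmetric convex hexagon tiles the plane by translations
(hence periodically): there are two linearly independent vectors `t₁, t₂` such
that the lattice translates of the hexagon cover the plane and have pairwise
disjoint interiors. -/
theorem centrally_symmetric_hexagon_tiles_by_translations
    (H : ConvexHexagon)
    (hsym : ∃ c : EuclideanSpace ℝ (Fin 2), (fun x => c - x) '' H.region = H.region) :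
    ∃ t₁ t₂ : EuclideanSpace ℝ (Fin 2),
      LinearIndependent ℝ ![t₁, t₂] ∧
      (⋃ (p : ℤ × ℤ), (fun x => x + ((p.1 : ℝ) • t₁ + (p.2 : ℝ) • t₂)) '' H.region)
        = Set.univ ∧
      ∀ p q : ℤ × ℤ, p ≠ q →
        Disjoint
          (interior ((fun x => x + ((p.1 : ℝ) • t₁ + (p.2 : ℝ) • t₂)) '' H.region))
          (interior ((fun x => x + ((q.1 : ℝ) • t₁ + (q.2 : ℝ) • t₂)) '' H.region)) := by
  obtain ⟨c, hc⟩ := hsym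
  obtain ⟨z, a, b, d, hR⟩ := region_hexa H c hc
  have key : TilesByLattice H.region := by
    rw [hR]
    apply mid_all
    rintro ⟨h1, h2, h3⟩
    have hvm : ∀ i, H.v i ∈ hexa z a b d := fun i => by
      rw [← hR]; exact subset_convexHull ℝ _ (mem_range_self i)
    obtain ⟨i0, j0, k0, e0⟩ := hexa_coords z a b d _ (hvm 0)
    obtain ⟨i1, j1, k1, e1⟩ := hexa_coords z a b d _ (hvm 1)
    obtain ⟨i2, j2, k2, e2⟩ := hexa_coords z a b d _ (hvm 2)
    have h0 := H.convex 0
    simp only [zero_add] at h0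
    rw [e0, e1, e2] at h0
    simp only [PiLp.add_apply, PiLp.sub_apply, PiLp.smul_apply, smul_eq_mul] at h0
    simp only [cr] at h1 h2 h3
    apply h0.ne'
    linear_combination ((i1 - i0) * (j2 - j1) - (j1 - j0) * (i2 - i1)) * h1 +
      ((j1 - j0) * (k2 - k1) - (k1 - k0) * (j2 - j1)) * h2 +
      ((k1 - k0) * (i2 - i1) - (i1 - i0) * (k2 - k1)) * h3
  exact key
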